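/- arXiv:2103.14014 — 2 statements merged into one kernel-verified Lean document; each statement's English description precedes it below -/
import Mathlib

section
/- Set p = 1/2 (so b = 2). For every constant C > 0 there is a constant K and n₀ such that the following holds for all n ≥ n₀: if k < n are positive reals and t ≤ a are positive integers with |a − α₀(n)| ≤ C, |t − α₀(n)| ≤ C, n/k ≥ 2 and 1/C ≤ t − n/k ≤ C, then, writing ρ = n/k, |L̂₀(n,k,t) − [(a − ρ − 1 − 2/log 2)(log n − log log n) + log(μ_a(n))]| ≤ K, where μ_a(n) = binom(n,a)·2^{−binom(a,2)}. -/
open Filter Real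

/-- `d_i = 2^C(i,2) i!`. -/
noncomputable def dI (i : ℕ) : ℝ := 2 ^ i.choose 2 * (i.factorial : ℝ)

/-- `P̃_{ρ,t}`: the set of `(p_1,…,p_t) ∈ [0,1]^t` with `Σ p_i = 1` and `Σ i p_i = ρ`
(index `i : Fin t` denotes size `i+1`). -/
def Ptilde (ρ : ℝ) (t : ℕ) : Set (Fin t → ℝ) :=
  {q | (∀ i, q i ∈ Set.Icc (0 : ℝ) 1) ∧ (∑ i, q i) = 1 ∧
    (∑ i, ((i.1 + 1 : ℕ) : ℝ) * q i) = ρ}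

/-- `L̃(ρ,k,p) = ρ log(ρk) − log k − ρ + 1 − Σ p_i log(p_i d_i)`. -/
noncomputable def Ltilde (ρ k : ℝ) {t : ℕ} (q : Fin t → ℝ) : ℝ :=
  ρ * Real.log (ρ * k) - Real.log k - ρ + 1 -
    ∑ i, q i * Real.log (q i * dI (i.1 + 1))

/-- `L̃₀(ρ,k,t) = sup {L̃(ρ,k,p) : p ∈ P̃_{ρ,t}}`. -/
noncomputable def Ltilde0 (ρ k : ℝ) (t : ℕ) : ℝ :=
  sSup {L : ℝ | ∃ q ∈ Ptilde ρ t, L = Ltilde ρ k q}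

/-- `L̂₀(n,k,t) = L̃₀(n/k, k, t)`. -/
noncomputable def Lhat0 (n k : ℝ) (t : ℕ) : ℝ := Ltilde0 (n / k) k t

/-- `α₀(n)` (for `p = 1/2`, take `b = 2`). -/
noncomputable def alpha0 (b : ℝ) (x : ℝ) : ℝ :=
  2 * Real.logb b x - 2 * Real.logb b (Real.logb b x) + 2 * Real.logb b (Real.exp 1 / 2) + 1

/-- `μ_a(x) = C(x,a) 2^{−C(a,2)}` extended to a real variable `x` via the falling
factorial (for `q = 1/2`). -/
noncomputable def muR (q : ℝ) (a : ℕ) (x : ℝ) : ℝ :=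
  (∏ i ∈ Finset.range a, (x - i)) / (a.factorial : ℝ) * q ^ a.choose 2

lemma dI_pos (i : ℕ) : 0 < dI i := by
  unfold dI; positivity

lemma log_dI_succ (i : ℕ) :
    log (dI (i + 1)) = log (dI i) + (i * log 2 + log ((i : ℝ) + 1)) := by
  have h : dI (i + 1) = dI i * (2 ^ i * ((i : ℝ) + 1)) := by
    unfold dI
    rw [Nat.choose_succ_succ' i 1, Nat.choose_one_right, Nat.factorial_succ]
    push_cast
    ring
  rw [h, log_mul (dI_pos i).ne' (by positivity), log_mul (by positivity) (by positivity), log_pow]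

lemma log_dI_add_ge {i : ℕ} (hi : 0 < i) (j : ℕ) :
    log (dI i) + j * (i * log 2 + log i) ≤ log (dI (i + j)) := by
  have hi' : (0 : ℝ) < i := by exact_mod_cast hi
  have h2 : 0 < log 2 := log_pos one_lt_two
  induction j with
  | zero => simp
  | succ j ih =>
    rw [← add_assoc, log_dI_succ]
    push_cast
    have h1 : log (i : ℝ) ≤ log ((i : ℝ) + j + 1) :=
      log_le_log hi' (by have : (0 : ℝ) ≤ j := j.cast_nonneg; linarith)
    have h3 : (0 : ℝ) ≤ j * log 2 := by positivity
    linarith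

lemma log_dI_add_le {i : ℕ} (hi : 0 < i) (j : ℕ) :
    log (dI (i + j)) ≤
      log (dI i) + j * (((i + j : ℕ) : ℝ) * log 2 + log ((i + j : ℕ) : ℝ)) - j * log 2 := by
  have h2 : 0 < log 2 := log_pos one_lt_two
  have hi' : (0 : ℝ) < i := by exact_mod_cast hi
  induction j with
  | zero => simp
  | succ j ih =>
    rw [← add_assoc, log_dI_succ]
    have hj : (0 : ℝ) ≤ j := j.cast_nonneg
    push_cast at ih ⊢
    have h1 : (j : ℝ) * log ((i : ℝ) + j) ≤ j * log ((i : ℝ) + j + 1) :=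
      mul_le_mul_of_nonneg_left (log_le_log (by linarith) (by linarith)) hj
    have h3 : (0 : ℝ) ≤ j * log 2 := by positivity
    linarith

lemma log_add_le_log_add_log_two {i j : ℕ} (hi : 0 < i) (hj : j ≤ i) :
    log ((i + j : ℕ) : ℝ) ≤ log i + log 2 := by
  have hi' : (0 : ℝ) < i := by exact_mod_cast hi
  have hj' : (j : ℝ) ≤ i := by exact_mod_cast hj
  rw [← log_mul hi'.ne' two_ne_zero]
  push_cast
  exact log_le_log (by positivity) (by linarith)

lemma mul_log_mul_ge {x : ℝ} (hx : 0 ≤ x) (j : ℕ) :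
    x - (1 / 2) ^ j ≤ x * log x + x * (j * log 2) := by
  rcases hx.eq_or_lt with rfl | hx
  · simp
  have h := one_sub_inv_le_log_of_pos (show 0 < x * 2 ^ j by positivity)
  rw [log_mul hx.ne' (by positivity), log_pow] at h
  have h' := mul_le_mul_of_nonneg_left h hx.le
  have e : x * (1 - (x * 2 ^ j)⁻¹) = x - (1 / 2) ^ j := by
    rw [one_div, inv_pow]
    field_simp
  linarith

lemma mul_log_mul_dI {x : ℝ} (i : ℕ) :
    x * log (x * dI i) = x * log x + x * log (dI i) := by
  rcases eq_or_ne x 0 with rfl | hx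
  · simp
  rw [log_mul hx (dI_pos i).ne']
  ring

lemma sum_mul_log_ge {ρ : ℝ} {t : ℕ} {q : Fin t → ℝ} (hq : q ∈ Ptilde ρ t) :
    log (dI t) - (t - ρ) * (t * log 2 + log t) - 1 ≤
      ∑ i, q i * log (q i * dI (i.1 + 1)) := by
  obtain ⟨h01, hsum, hmean⟩ := hq
  have hterm : ∀ i : Fin t, q i * (log (dI t) - t * (t * log 2 + log t) + 1)
      + ((i.1 + 1 : ℕ) : ℝ) * q i * (t * log 2 + log t) - (1 / 2) ^ (t - 1 - i.1) ≤
      q i * log (q i * dI (i.1 + 1)) := by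
    intro i
    obtain ⟨j, hj⟩ : ∃ j, t = i.1 + 1 + j := ⟨t - (i.1 + 1), by omega⟩
    have hj' : t - 1 - i.1 = j := by omega
    rw [mul_log_mul_dI, hj']
    have h1 := mul_log_mul_ge (h01 i).1 j
    have h2 := log_dI_add_le (Nat.succ_pos i.1) j
    rw [Nat.succ_eq_add_one, ← hj] at h2
    have h3 := mul_le_mul_of_nonneg_left h2 (h01 i).1
    have h4 : ((i.1 + 1 : ℕ) : ℝ) = t - j := by
      rw [eq_sub_iff_add_eq]; exact_mod_cast hj.symm
    rw [h4]
    linarith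
  have hgeom : ∑ i : Fin t, (1 / 2 : ℝ) ^ (t - 1 - i.1) ≤ 2 := by
    rw [Fin.sum_univ_eq_sum_range (fun i => (1 / 2 : ℝ) ^ (t - 1 - i)),
      Finset.sum_range_reflect (fun i => (1 / 2 : ℝ) ^ i)]
    exact sum_geometric_two_le t
  have h := Finset.sum_le_sum (fun i (_ : i ∈ Finset.univ) => hterm i)
  rw [Finset.sum_sub_distrib, Finset.sum_add_distrib, ← Finset.sum_mul, ← Finset.sum_mul,
    hsum, hmean] at h
  linarith

lemma exists_mem_Ptilde_sum_mul_log_le {ρ : ℝ} {t J : ℕ} (hJ : 0 < J) (hJt : 2 * J ≤ t)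
    (h0 : 0 ≤ t - ρ) (h1 : t - ρ ≤ J) :
    ∃ q ∈ Ptilde ρ t, ∑ i, q i * log (q i * dI (i.1 + 1)) ≤
      log (dI t) - (t - ρ) * (t * log 2 + log t) + (J ^ 2 + J) * log 2 := by
  obtain ⟨m, rfl⟩ : ∃ m, t = m + 1 + J := ⟨t - J - 1, by omega⟩
  have hJ' : (0 : ℝ) < J := by exact_mod_cast hJ
  set s : ℝ := ((m + 1 + J : ℕ) : ℝ) - ρ with hs
  set w : ℝ := s / J with hw
  have hw0 : 0 ≤ w := by positivity
  have hw1 : w ≤ 1 := (div_le_one hJ').2 h1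
  have hwJ : w * J = s := div_mul_cancel₀ _ hJ'.ne'
  let x : Fin (m + 1 + J) := ⟨m + J, by omega⟩
  let y : Fin (m + 1 + J) := ⟨m, by omega⟩
  have hxy : x ≠ y := by simp [x, y, Fin.ext_iff]; omega
  let q : Fin (m + 1 + J) → ℝ :=
    fun i => (if i = x then 1 - w else 0) + (if i = y then w else 0)
  have hlin : ∀ g : Fin (m + 1 + J) → ℝ, ∑ i, q i * g i = (1 - w) * g x + w * g y := by
    intro g
    simp [q, add_mul, Finset.sum_add_distrib]
  have hq01 : ∀ i, q i ∈ Set.Icc (0 : ℝ) 1 := by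
    intro i
    by_cases hix : i = x
    · simp [q, hix, hxy, hw0, hw1]
    · by_cases hiy : i = y
      · simp [q, hiy, hxy.symm, hw0, hw1]
      · simp [q, hix, hiy]
  refine ⟨q, ⟨hq01, ?_, ?_⟩, ?_⟩
  · have := hlin fun _ => 1
    simpa using this
  · have := hlin fun i => ((i.1 + 1 : ℕ) : ℝ)
    simp only [mul_comm (q _)] at this
    rw [this]
    simp only [x, y]
    push_cast at hs ⊢
    linarith
  · have hle : ∑ i, q i * log (q i * dI (i.1 + 1)) ≤ ∑ i, q i * log (dI (i.1 + 1)) := by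
      refine Finset.sum_le_sum fun i _ => ?_
      rw [mul_log_mul_dI]
      have := mul_nonpos_of_nonneg_of_nonpos (hq01 i).1 (log_nonpos (hq01 i).1 (hq01 i).2)
      linarith
    rw [hlin fun i => log (dI (i.1 + 1))] at hle
    refine hle.trans ?_
    have e : m + J + 1 = m + 1 + J := by omega
    simp only [x, y, e]
    have hd := log_dI_add_ge (Nat.succ_pos m) J
    have hl := log_add_le_log_add_log_two (Nat.succ_pos m) (show J ≤ m + 1 by omega)
    rw [Nat.succ_eq_add_one] at hd hl
    set X : ℝ := ((m + 1 + J : ℕ) : ℝ) * log 2 + log ((m + 1 + J : ℕ) : ℝ) with hX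
    have hstep : log (dI (m + 1)) ≤ log (dI (m + 1 + J)) - J * X + (J ^ 2 + J) * log 2 := by
      have h5 : X - J * log 2 - log 2 ≤ ((m + 1 : ℕ) : ℝ) * log 2 + log ((m + 1 : ℕ) : ℝ) := by
        rw [hX, Nat.cast_add (m + 1) J] at *
        linarith
      have h6 := mul_le_mul_of_nonneg_left h5 hJ'.le
      linarith
    have h7 := mul_le_mul_of_nonneg_left hstep hw0
    have h8 : w * ((J ^ 2 + J) * log 2) ≤ (J ^ 2 + J) * log 2 :=
      mul_le_of_le_one_left (by have := log_pos one_lt_two; positivity) hw1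
    have h9 : s * X = w * J * X := by rw [hwJ]
    linarith

lemma abs_Ltilde0_sub_le {ρ k : ℝ} {t J : ℕ} (hJ : 0 < J) (hJt : 2 * J ≤ t)
    (h0 : 0 ≤ t - ρ) (h1 : t - ρ ≤ J) :
    |Ltilde0 ρ k t - (ρ * log (ρ * k) - log k - ρ + 1 - log (dI t)
      + (t - ρ) * (t * log 2 + log t))| ≤ (J ^ 2 + J) * log 2 + 1 := by
  obtain ⟨q, hq, hqle⟩ := exists_mem_Ptilde_sum_mul_log_le hJ hJt h0 h1
  have hub : ∀ L ∈ {L : ℝ | ∃ q ∈ Ptilde ρ t, L = Ltilde ρ k q},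
      L ≤ ρ * log (ρ * k) - log k - ρ + 1 - log (dI t)
        + (t - ρ) * (t * log 2 + log t) + 1 := by
    rintro L ⟨p, hp, rfl⟩
    have := sum_mul_log_ge hp
    unfold Ltilde
    linarith
  have hle : Ltilde0 ρ k t ≤ _ := csSup_le ⟨_, q, hq, rfl⟩ hub
  have hge : Ltilde ρ k q ≤ Ltilde0 ρ k t := le_csSup ⟨_, hub⟩ ⟨q, hq, rfl⟩
  unfold Ltilde at hge
  have hpos : 0 ≤ ((J : ℝ) ^ 2 + J) * log 2 := by
    have := log_pos one_lt_two; positivity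
  rw [abs_le]
  constructor <;> linarith

lemma abs_log_dI_add_sub_le {t r J : ℕ} (ht : 0 < t) (hr : r ≤ J) (hJt : J ≤ t) :
    |log (dI (t + r)) - (log (dI t) + r * (t * log 2 + log t))| ≤ (J ^ 2 + J) * log 2 := by
  have h1 := log_dI_add_ge ht r
  have h2 := log_dI_add_le ht r
  have h3 := mul_le_mul_of_nonneg_left
    (log_add_le_log_add_log_two ht (hr.trans hJt)) (Nat.cast_nonneg (α := ℝ) r)
  have hlog : 0 < log 2 := log_pos one_lt_two
  have hr' : (r : ℝ) ≤ J := by exact_mod_cast hr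
  have h4 : ((r : ℝ) ^ 2 + r) * log 2 ≤ (J ^ 2 + J) * log 2 := by gcongr
  have h5 : 0 ≤ (r : ℝ) * log 2 := by positivity
  have h6 : 0 ≤ ((J : ℝ) ^ 2 + J) * log 2 := by positivity
  push_cast at h2 h3
  rw [abs_le]
  constructor
  · linarith
  · linarith

lemma abs_log_muR_sub_le {n : ℝ} {a : ℕ} (hn : 0 < n) (ha : 2 * (a : ℝ) ^ 2 ≤ n) :
    |log (muR (1 / 2) a n) - (a * log n - log (dI a))| ≤ 1 := by
  have hmem : ∀ i ∈ Finset.range a, n / 2 ≤ n - i := by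
    intro i hi
    have hi' : (i : ℝ) ≤ a := by exact_mod_cast (Finset.mem_range.1 hi).le
    have h1 : (1 : ℝ) ≤ a := by
      exact_mod_cast Nat.one_le_iff_ne_zero.2 (by rintro rfl; simp at hi)
    nlinarith
  have hprod : (∏ i ∈ Finset.range a, (n - i)) ≠ 0 :=
    Finset.prod_ne_zero_iff.2 fun i hi => by have := hmem i hi; linarith
  have hmu : log (muR (1 / 2) a n) = ∑ i ∈ Finset.range a, log (n - i) - log (dI a) := by
    have : muR (1 / 2) a n = (∏ i ∈ Finset.range a, (n - i)) / dI a := by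
      unfold muR dI
      rw [one_div, inv_pow]
      field_simp
    rw [this, log_div hprod (dI_pos a).ne', log_prod]
    intro i hi
    have := hmem i hi
    linarith
  have hlo : ∀ i ∈ Finset.range a, log n - 2 * a / n ≤ log (n - i) := by
    intro i hi
    have hni := hmem i hi
    have hpos : 0 < n - i := by linarith
    have hi' : (i : ℝ) ≤ a := by exact_mod_cast (Finset.mem_range.1 hi).le
    have h := one_sub_inv_le_log_of_pos (div_pos hpos hn)
    rw [log_div hpos.ne' hn.ne', inv_div] at h
    have h2 : n / (n - i) - 1 ≤ 2 * a / n := by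
      rw [div_sub_one hpos.ne', div_le_div_iff₀ hpos hn]
      nlinarith
    linarith
  have hup : ∀ i ∈ Finset.range a, log (n - i) ≤ log n := by
    intro i hi
    have hni := hmem i hi
    exact log_le_log (by linarith) (by have : (0 : ℝ) ≤ i := i.cast_nonneg; linarith)
  have hlo' := Finset.sum_le_sum hlo
  have hup' := Finset.sum_le_sum hup
  simp only [Finset.sum_const, Finset.card_range, nsmul_eq_mul] at hlo' hup'
  have h3 : (a : ℝ) * (2 * a / n) ≤ 1 := by
    rw [← mul_div_assoc, div_le_one hn]
    linarith
  rw [hmu, abs_le]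
  constructor <;> linarith

lemma alpha0_two_eq {n : ℝ} (hn : 1 < n) :
    alpha0 2 n = 2 / log 2 * (log n - log (log n))
      + (2 / log 2 * (log (log 2) + 1 - log 2) + 1) := by
  have h2 : 0 < log 2 := log_pos one_lt_two
  unfold alpha0
  simp only [logb]
  rw [log_div (log_pos hn).ne' h2.ne', log_div (exp_pos 1).ne' two_ne_zero, log_exp]
  ring

lemma eventually_log_bounds (B : ℝ) :
    ∀ᶠ n : ℝ in atTop, 1 < n ∧ B ≤ log n ∧ 0 ≤ log (log n) ∧
      log (log n) ≤ log n / 6 ∧ 32 * log n ^ 2 ≤ n := by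
  have h1 := (isLittleO_log_id_atTop.comp_tendsto tendsto_log_atTop).def
    (show (0 : ℝ) < 1 / 6 by norm_num)
  have h2 := (isLittleO_pow_log_id_atTop (n := 2)).def (show (0 : ℝ) < 1 / 32 by norm_num)
  filter_upwards [h1, h2, eventually_gt_atTop (1 : ℝ),
    tendsto_log_atTop.eventually_ge_atTop (max B 1)] with n h1 h2 hn hlog
  have hl : 1 ≤ log n := (le_max_right _ _).trans hlog
  simp only [Function.comp, id, norm_eq_abs] at h1 h2
  rw [abs_of_nonneg (by linarith : 0 ≤ log n)] at h1
  rw [abs_of_nonneg (by linarith : 0 ≤ n)] at h2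
  have h3 := (le_abs_self _).trans h1
  have h4 := (le_abs_self _).trans h2
  exact ⟨hn, (le_max_left _ _).trans hlog, log_nonneg hl, by linarith, by linarith⟩

lemma abs_log_sub_log_le_two {x N : ℝ} (hN : 0 < N) (h1 : N ≤ x) (h2 : x ≤ 4 * N) :
    |log x - log N| ≤ 2 := by
  have h3 := log_le_log hN h1
  have h4 := log_le_log (hN.trans_le h1) h2
  rw [log_mul (by norm_num) hN.ne', show (4 : ℝ) = 2 ^ 2 by norm_num, log_pow] at h4
  have := log_two_lt_d9
  push_cast at h4
  rw [abs_le]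
  constructor <;> linarith

/-- Take `p = 1/2`.  For every constant `C > 0` there are `K` and `n₀` such
that for all real `n ≥ n₀`: if `0 < k < n` are reals and `t ≤ a` are positive integers with
`|a − α₀(n)| ≤ C`, `|t − α₀(n)| ≤ C`, `n/k ≥ 2` and `1/C ≤ t − n/k ≤ C`, then, with
`ρ = n/k`, `L̂₀(n,k,t) = (a − ρ − 1 − 2/log 2)(log n − log log n) + log μ_a(n) + O(1)`. -/
theorem Lhat0_approx (C : ℝ) (hC : 0 < C) :
    ∃ K n₀ : ℝ, ∀ n : ℝ, n₀ ≤ n → ∀ k : ℝ, 0 < k → k < n →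
      ∀ t a : ℕ, 0 < t → t ≤ a →
      |(a : ℝ) - alpha0 2 n| ≤ C → |(t : ℝ) - alpha0 2 n| ≤ C →
      2 ≤ n / k → 1 / C ≤ (t : ℝ) - n / k → (t : ℝ) - n / k ≤ C →
      |Lhat0 n k t - (((a : ℝ) - n / k - 1 - 2 / Real.log 2)
            * (Real.log n - Real.log (Real.log n))
          + Real.log (muR (1 / 2) a n))| ≤ K := by
  obtain ⟨c, hc⟩ : ∃ c : ℝ, c = 2 / log 2 * (log (log 2) + 1 - log 2) + 1 := ⟨_, rfl⟩
  obtain ⟨J, hJ⟩ := exists_nat_gt (2 * C)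
  have hJ0 : 0 < J := by
    have : (0 : ℝ) < J := by linarith
    exact_mod_cast this
  obtain ⟨n₀, hn₀⟩ := eventually_atTop.1
    (eventually_log_bounds (max (2 * J) (3 * (|c| + 2 * C))))
  refine ⟨2 * ((J ^ 2 + J) * log 2) + 3 * C * (|c| + C + 2) + |c| + 2 * C + 5, n₀, ?_⟩
  intro n hn k hk hkn t a ht hta ha hta' hρ hs1 hs2
  obtain ⟨hn1, hB, hM0, hM, hsq⟩ := hn₀ n hn
  have hn0 : 0 < n := by linarith
  have hB1 : 2 * (J : ℝ) ≤ log n := (le_max_left _ _).trans hB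
  have hB2 : 3 * (|c| + 2 * C) ≤ log n := (le_max_right _ _).trans hB
  rw [alpha0_two_eq hn1, ← hc] at ha hta'
  have hkeq : log k = log n - log (n / k) := by
    rw [log_div hn0.ne' hk.ne']; ring
  have hρk : n / k * k = n := div_mul_cancel₀ n hk.ne'
  have hs0 : 0 ≤ (t : ℝ) - n / k := (one_div_pos.2 hC).le.trans hs1
  unfold Lhat0
  set ρ := n / k with hρdef
  set N := log n with hN
  set M := log N with hMdef
  have hNpos : 0 < N := log_pos hn1
  have hl1 := log_two_gt_d9
  have hl2 := log_two_lt_d9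
  set b : ℝ := 2 / log 2 with hb
  have hbl : b * log 2 = 2 := div_mul_cancel₀ _ (by positivity)
  have hb1 : 2.8 ≤ b := by rw [hb, le_div_iff₀ (by linarith)]; linarith
  have hb2 : b ≤ 3 := by rw [hb, div_le_iff₀ (by linarith)]; linarith
  have hNM : 0 ≤ N - M := by linarith
  have hNM1 : 2 * N ≤ b * (N - M) :=
    le_trans (by linarith) (mul_le_mul_of_nonneg_right hb1 hNM)
  have hNM2 : b * (N - M) ≤ 3 * N :=
    (mul_le_mul_of_nonneg_right hb2 hNM).trans (by linarith)
  have hc1 := neg_abs_le c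
  have hc2 := le_abs_self c
  have hc3 := abs_nonneg c
  have ha' := abs_le.1 ha
  have ht' := abs_le.1 hta'
  have ht1 : N ≤ t := by linarith
  have ht2 : (t : ℝ) ≤ 4 * N := by linarith
  have hρ1 : N ≤ ρ := by linarith
  have hρ2 : ρ ≤ 4 * N := by linarith
  have ha0 : (0 : ℝ) ≤ a := a.cast_nonneg
  have ha2 : (a : ℝ) ≤ 4 * N := by linarith
  have hJt : 2 * J ≤ t := by
    have : 2 * (J : ℝ) ≤ t := hB1.trans ht1
    exact_mod_cast this
  obtain ⟨r, rfl⟩ := Nat.exists_eq_add_of_le hta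
  have hrJ : r ≤ J := by
    have : (r : ℝ) ≤ J := by push_cast at ha'; linarith
    exact_mod_cast this
  have e1 := abs_le.1 <| abs_Ltilde0_sub_le (k := k) hJ0 hJt hs0 (by linarith)
  have e2 := abs_le.1 <| abs_log_muR_sub_le (a := t + r) hn0
    (by have := pow_le_pow_left₀ ha0 ha2 2; linarith)
  have e3 := abs_le.1 <| abs_log_dI_add_sub_le ht hrJ (by omega)
  have e5 := abs_le.1 <| abs_log_sub_log_le_two hNpos hρ1 hρ2
  have e7 := abs_le.1 <| abs_log_sub_log_le_two hNpos ht1 ht2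
  have e4 : |(t : ℝ) * log 2 + log t - (2 * N - M)| ≤ |c| + C + 2 := by
    have h : (t : ℝ) * log 2 - 2 * (N - M) = log 2 * (t - b * (N - M)) := by
      linear_combination (N - M) * hbl
    have h2 : |log 2 * (t - b * (N - M))| ≤ |c| + C := by
      rw [abs_mul, abs_of_pos (by linarith : 0 < log 2)]
      have h3 : |(t : ℝ) - b * (N - M)| ≤ |c| + C := by
        rw [abs_le]; constructor <;> linarith
      exact (mul_le_of_le_one_left (abs_nonneg _) (by linarith)).trans h3
    have h4 := abs_le.1 h2
    rw [abs_le]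
    constructor <;> linarith
  rw [hρk, hkeq] at e1
  push_cast at *
  set X : ℝ := t * log 2 + log t with hX
  have e6 : |(t + r - ρ) * (X - (2 * N - M))| ≤ 3 * C * (|c| + C + 2) := by
    rw [abs_mul]
    refine mul_le_mul ?_ e4 (abs_nonneg _) (by positivity)
    have : (0 : ℝ) ≤ r := r.cast_nonneg
    rw [abs_le]; constructor <;> linarith
  have e6' := abs_le.1 e6
  rw [abs_le]
  constructor <;> linarith
end

section
/- Set p = 1/2 (so b = 2) and suppose t = t(n) is a positive integer with t(n) = α₀(n) + O(1). Then, uniformly over all real k ≤ n/2 such that n/k = t − Θ(1) (i.e. for all constants C > c > 0 there are positive constants c', C' and n₀ such that for n ≥ n₀ and c < t − n/k < C): ∂L̂₀(n,k,t)/∂k lies in [c'·log³n/n, C'·log³n/n]; ∂L̂₀(n,k,t)/∂n lies in [−C'·log²n/n, −c'·log²n/n]; and |∂(k·L̂₀(n,k,t))/∂k − (2/log 2)·log² n| ≤ C'·log n·log log n. -/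
open Filter Real

/-- The unnormalised Gibbs weight `e^{l m} / d_m`. -/
noncomputable def gibbsWeight (l : ℝ) (m : ℕ) : ℝ := exp (l * m) / dI m

/-- The partition function of the Gibbs weights on `{1, …, t}`. -/
noncomputable def partitionFn (t : ℕ) (l : ℝ) : ℝ := ∑ i : Fin t, gibbsWeight l (i.1 + 1)

/-- The unnormalised difference between the mean of the Gibbs measure and `ρ`. -/
noncomputable def meanDefect (t : ℕ) (ρ l : ℝ) : ℝ :=
  ∑ i : Fin t, (((i.1 + 1 : ℕ) : ℝ) - ρ) * gibbsWeight l (i.1 + 1)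

lemma gibbsWeight_pos (l : ℝ) (m : ℕ) : 0 < gibbsWeight l m :=
  div_pos (exp_pos _) (dI_pos m)

lemma partitionFn_pos {t : ℕ} (ht : 0 < t) (l : ℝ) : 0 < partitionFn t l :=
  Finset.sum_pos (fun _ _ => gibbsWeight_pos _ _) ⟨⟨0, ht⟩, Finset.mem_univ _⟩

lemma log_gibbsWeight_mul_dI (l : ℝ) (m : ℕ) : log (gibbsWeight l m * dI m) = l * m := by
  rw [gibbsWeight, div_mul_cancel₀ _ (dI_pos m).ne', log_exp]

lemma mul_log_mul_ge_s16 {q w d : ℝ} (hq : 0 ≤ q) (hw : 0 < w) (hd : 0 < d) :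
    q * log (w * d) + (q - w) ≤ q * log (q * d) := by
  rcases hq.eq_or_lt with rfl | hq
  · simp [hw.le]
  · have h := mul_le_mul_of_nonneg_left (log_le_sub_one_of_pos (div_pos hw hq)) hq.le
    rw [log_div hw.ne' hq.ne', mul_sub q (w / q), mul_div_cancel₀ _ hq.ne'] at h
    rw [log_mul hw.ne' hd.ne', log_mul hq.ne' hd.ne']
    linarith

lemma Ltilde_le {ρ : ℝ} {t : ℕ} {q : Fin t → ℝ} (hq : q ∈ Ptilde ρ t) (k l : ℝ) :
    Ltilde ρ k q ≤
      ρ * log (ρ * k) - log k - ρ + 1 + (log (partitionFn t l) - l * ρ) := by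
  obtain ⟨h01, hsum, hmean⟩ := hq
  have ht : 0 < t := by
    rcases Nat.eq_zero_or_pos t with rfl | h
    · simp at hsum
    · exact h
  have hZ := partitionFn_pos ht l
  have hterm : ∀ i : Fin t,
      q i * (l * ((i.1 + 1 : ℕ) : ℝ)) - q i * log (partitionFn t l)
        + (q i - gibbsWeight l (i.1 + 1) / partitionFn t l)
        ≤ q i * log (q i * dI (i.1 + 1)) := by
    intro i
    have h := mul_log_mul_ge_s16 (h01 i).1 (div_pos (gibbsWeight_pos l (i.1 + 1)) hZ)
      (dI_pos (i.1 + 1))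
    rw [div_mul_eq_mul_div, log_div (mul_pos (gibbsWeight_pos _ _) (dI_pos _)).ne' hZ.ne',
      log_gibbsWeight_mul_dI] at h
    linarith
  have h := Finset.sum_le_sum fun i (_ : i ∈ Finset.univ) => hterm i
  have h1 : ∑ i : Fin t, q i * (l * ((i.1 + 1 : ℕ) : ℝ)) = l * ρ := by
    rw [← hmean, Finset.mul_sum]
    exact Finset.sum_congr rfl fun i _ => by ring
  have h2 : ∑ i : Fin t, gibbsWeight l (i.1 + 1) / partitionFn t l = 1 := by
    rw [← Finset.sum_div]
    exact div_self hZ.ne'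
  rw [Finset.sum_add_distrib, Finset.sum_sub_distrib, Finset.sum_sub_distrib, h1, h2,
    ← Finset.sum_mul, hsum] at h
  unfold Ltilde
  linarith

lemma exists_Ltilde_eq {ρ l : ℝ} {t : ℕ} (ht : 0 < t) (hl : meanDefect t ρ l = 0) (k : ℝ) :
    ∃ q ∈ Ptilde ρ t, ρ * log (ρ * k) - log k - ρ + 1 + (log (partitionFn t l) - l * ρ)
      = Ltilde ρ k q := by
  have hZ := partitionFn_pos ht l
  have h2 : ∑ i : Fin t, gibbsWeight l (i.1 + 1) / partitionFn t l = 1 := by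
    rw [← Finset.sum_div]
    exact div_self hZ.ne'
  have hpos : ∀ i : Fin t, 0 ≤ gibbsWeight l (i.1 + 1) / partitionFn t l :=
    fun i => (div_pos (gibbsWeight_pos _ _) hZ).le
  have hmean : ∑ i : Fin t, ((i.1 + 1 : ℕ) : ℝ) * (gibbsWeight l (i.1 + 1) / partitionFn t l)
      = ρ := by
    simp only [meanDefect, sub_mul, Finset.sum_sub_distrib, ← Finset.mul_sum] at hl
    simp only [← mul_div_assoc, ← Finset.sum_div]
    rw [div_eq_iff hZ.ne', partitionFn]
    linarith
  refine ⟨fun i => gibbsWeight l (i.1 + 1) / partitionFn t l,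
    ⟨fun i => ⟨hpos i, ?_⟩, h2, hmean⟩, ?_⟩
  · rw [← h2]
    exact Finset.single_le_sum (f := fun i : Fin t => gibbsWeight l (i.1 + 1) / partitionFn t l)
      (fun j _ => hpos j) (Finset.mem_univ i)
  · have hterm : ∀ i : Fin t, gibbsWeight l (i.1 + 1) / partitionFn t l *
        log (gibbsWeight l (i.1 + 1) / partitionFn t l * dI (i.1 + 1)) =
        l * (((i.1 + 1 : ℕ) : ℝ) * (gibbsWeight l (i.1 + 1) / partitionFn t l))
          - log (partitionFn t l) * (gibbsWeight l (i.1 + 1) / partitionFn t l) := by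
      intro i
      rw [div_mul_eq_mul_div (gibbsWeight l (i.1 + 1)) _ (dI (i.1 + 1)),
        log_div (mul_pos (gibbsWeight_pos _ _) (dI_pos _)).ne' hZ.ne', log_gibbsWeight_mul_dI]
      ring
    unfold Ltilde
    rw [Finset.sum_congr rfl fun i _ => hterm i, Finset.sum_sub_distrib, ← Finset.mul_sum,
      ← Finset.mul_sum, hmean, h2]
    ring

lemma Ltilde0_eq {ρ l : ℝ} {t : ℕ} (ht : 0 < t) (hl : meanDefect t ρ l = 0) (k : ℝ) :
    Ltilde0 ρ k t = ρ * log (ρ * k) - log k - ρ + 1 + (log (partitionFn t l) - l * ρ) := by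
  refine IsGreatest.csSup_eq ⟨exists_Ltilde_eq ht hl k, ?_⟩
  rintro _ ⟨q, hq, rfl⟩
  exact Ltilde_le hq k l

lemma log_partitionFn_sub_le {ρ l : ℝ} {t : ℕ} (ht : 0 < t) (hl : meanDefect t ρ l = 0)
    (l' : ℝ) : log (partitionFn t l) - l * ρ ≤ log (partitionFn t l') - l' * ρ := by
  obtain ⟨q, hq, h⟩ := exists_Ltilde_eq ht hl 1
  have := Ltilde_le hq 1 l'
  linarith

lemma continuous_meanDefect (t : ℕ) : Continuous fun x : ℝ × ℝ => meanDefect t x.1 x.2 := by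
  unfold meanDefect gibbsWeight
  fun_prop

lemma meanDefect_eq_exp_mul (t : ℕ) (ρ l : ℝ) :
    meanDefect t ρ l = exp (l * ρ) * ∑ i : Fin t, (((i.1 + 1 : ℕ) : ℝ) - ρ) *
      exp (l * (((i.1 + 1 : ℕ) : ℝ) - ρ)) / dI (i.1 + 1) := by
  rw [meanDefect, Finset.mul_sum]
  refine Finset.sum_congr rfl fun i _ => ?_
  rw [gibbsWeight, mul_sub l, exp_sub]
  field_simp

lemma strictMono_sum_mul_exp {ρ : ℝ} {t : ℕ} (ht : 0 < t) (hρ : ρ < t) :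
    StrictMono fun l : ℝ => ∑ i : Fin t, (((i.1 + 1 : ℕ) : ℝ) - ρ) *
      exp (l * (((i.1 + 1 : ℕ) : ℝ) - ρ)) / dI (i.1 + 1) := by
  intro l l' hll
  refine Finset.sum_lt_sum (fun i _ => ?_) ⟨⟨t - 1, by omega⟩, Finset.mem_univ _, ?_⟩
  · refine div_le_div_of_nonneg_right ?_ (dI_pos _).le
    rcases le_total 0 (((i.1 + 1 : ℕ) : ℝ) - ρ) with h | h
    · exact mul_le_mul_of_nonneg_left
        (exp_le_exp.2 (mul_le_mul_of_nonneg_right hll.le h)) h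
    · exact mul_le_mul_of_nonpos_left
        (exp_le_exp.2 (mul_le_mul_of_nonpos_right hll.le h)) h
  · have h : 0 < ((t - 1 + 1 : ℕ) : ℝ) - ρ := by
      rw [Nat.sub_add_cancel ht]
      linarith
    exact div_lt_div_of_pos_right
      (mul_lt_mul_of_pos_left (exp_lt_exp.2 (mul_lt_mul_of_pos_right hll h)) h) (dI_pos _)

lemma meanDefect_pos_of_gt {ρ l l' : ℝ} {t : ℕ} (ht : 0 < t) (hρ : ρ < t)
    (hl : meanDefect t ρ l = 0) (h : l < l') : 0 < meanDefect t ρ l' := by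
  rw [meanDefect_eq_exp_mul] at hl ⊢
  have h0 := (mul_eq_zero.1 hl).resolve_left (exp_pos _).ne'
  have := strictMono_sum_mul_exp ht hρ h
  simp only [h0] at this
  exact mul_pos (exp_pos _) this

lemma meanDefect_neg_of_lt {ρ l l' : ℝ} {t : ℕ} (ht : 0 < t) (hρ : ρ < t)
    (hl : meanDefect t ρ l = 0) (h : l' < l) : meanDefect t ρ l' < 0 := by
  rw [meanDefect_eq_exp_mul] at hl ⊢
  have h0 := (mul_eq_zero.1 hl).resolve_left (exp_pos _).ne'
  have := strictMono_sum_mul_exp ht hρ h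
  simp only [h0] at this
  exact mul_neg_of_pos_of_neg (exp_pos _) this

lemma exists_meanDefect_eq_zero {ρ a b : ℝ} {t : ℕ} (hab : a ≤ b) (ha : meanDefect t ρ a ≤ 0)
    (hb : 0 ≤ meanDefect t ρ b) : ∃ l ∈ Set.Icc a b, meanDefect t ρ l = 0 :=
  intermediate_value_Icc hab
    ((continuous_meanDefect t).comp (Continuous.prodMk_right ρ)).continuousOn ⟨ha, hb⟩

lemma eventually_exists_meanDefect_eq_zero {ρ l ε : ℝ} {t : ℕ} (ht : 0 < t) (hρ : ρ < t)
    (hl : meanDefect t ρ l = 0) (hε : 0 < ε) :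
    ∀ᶠ r in nhds ρ, ∃ l' ∈ Set.Icc (l - ε) (l + ε), meanDefect t r l' = 0 := by
  have hc : ∀ x : ℝ, Continuous fun r => meanDefect t r x := fun x =>
    (continuous_meanDefect t).comp (Continuous.prodMk_left x)
  have h1 := (hc (l - ε)).continuousAt.eventually_lt_const
    (meanDefect_neg_of_lt ht hρ hl (sub_lt_self l hε))
  have h2 := (hc (l + ε)).continuousAt.eventually_const_lt
    (meanDefect_pos_of_gt ht hρ hl (lt_add_of_pos_right l hε))
  filter_upwards [h1, h2] with r hr1 hr2
  exact exists_meanDefect_eq_zero (by linarith) hr1.le hr2.le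

/-- The envelope theorem for the entropy part of `Ltilde0`. -/
lemma exists_hasDerivAt_entropy {ρ l : ℝ} {t : ℕ} (ht : 0 < t) (hρ : ρ < t)
    (hl : meanDefect t ρ l = 0) :
    ∃ H : ℝ → ℝ, HasDerivAt H (-l) ρ ∧ H ρ = log (partitionFn t l) - l * ρ ∧
      ∀ᶠ r in nhds ρ, ∀ k, Ltilde0 r k t = r * log (r * k) - log k - r + 1 + H r := by
  set H : ℝ → ℝ := fun r => Ltilde0 r 1 t - (r * log (r * 1) - log 1 - r + 1) with hH
  have hHeq : ∀ r l', meanDefect t r l' = 0 → H r = log (partitionFn t l') - l' * r := by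
    intro r l' h
    simp only [hH, Ltilde0_eq ht h]
    ring
  refine ⟨H, ?_, hHeq ρ l hl, ?_⟩
  · rw [hasDerivAt_iff_isLittleO, Asymptotics.isLittleO_iff]
    intro ε hε
    filter_upwards [eventually_exists_meanDefect_eq_zero ht hρ hl hε] with r hr
    obtain ⟨l', ⟨hl1, hl2⟩, hl'⟩ := hr
    rw [hHeq r l' hl', hHeq ρ l hl, smul_eq_mul, norm_eq_abs, norm_eq_abs]
    have h1 := log_partitionFn_sub_le ht hl l'
    have h2 := log_partitionFn_sub_le ht hl' l
    have h3 : |(l' - l) * (r - ρ)| ≤ ε * |r - ρ| := by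
      rw [abs_mul]
      exact mul_le_mul_of_nonneg_right (abs_le.2 ⟨by linarith, by linarith⟩) (abs_nonneg _)
    rw [abs_le] at h3 ⊢
    constructor <;> nlinarith
  · filter_upwards [eventually_exists_meanDefect_eq_zero ht hρ hl one_pos] with r hr k
    obtain ⟨l', -, hl'⟩ := hr
    rw [hHeq r l' hl', Ltilde0_eq ht hl']

lemma hasDerivAt_Lhat0_right {n k l : ℝ} {t : ℕ} (ht : 0 < t) (hn : 0 < n) (hk : 0 < k)
    (hρ : n / k < t) (hl : meanDefect t (n / k) l = 0) :
    HasDerivAt (fun k' => Lhat0 n k' t) (n / k / n * (n / k * (l + 1 - log n) - 1)) k := by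
  obtain ⟨H, hH, -, hev⟩ := exists_hasDerivAt_entropy ht hρ hl
  have hdiv : HasDerivAt (fun k' : ℝ => n / k') (-n / k ^ 2) k := by
    simpa [div_eq_mul_inv, neg_mul, mul_neg] using (hasDerivAt_inv hk.ne').const_mul n
  have hd := (((((hdiv.mul_const (log n)).sub (hasDerivAt_log hk.ne')).sub hdiv).add_const 1).add
    (hH.comp k hdiv))
  refine (hd.congr_of_eventuallyEq ?_).congr_deriv ?_
  · filter_upwards [hdiv.continuousAt.eventually hev, eventually_gt_nhds hk] with x hx hx0
    simp only [Lhat0, hx, Pi.add_apply, Pi.sub_apply, Function.comp_apply]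
    rw [div_mul_cancel₀ _ hx0.ne']
  · field_simp
    ring

lemma hasDerivAt_Lhat0_left {n k l : ℝ} {t : ℕ} (ht : 0 < t) (hn : 0 < n) (hk : 0 < k)
    (hρ : n / k < t) (hl : meanDefect t (n / k) l = 0) :
    HasDerivAt (fun x => Lhat0 x k t) (n / k / n * (log n - l)) n := by
  obtain ⟨H, hH, -, hev⟩ := exists_hasDerivAt_entropy ht hρ hl
  have hdiv : HasDerivAt (fun x : ℝ => x / k) (1 / k) n := (hasDerivAt_id n).div_const k
  have hd := (((((hdiv.mul (hasDerivAt_log hn.ne')).sub_const (log k)).sub hdiv).add_const 1).add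
    (hH.comp n hdiv))
  refine (hd.congr_of_eventuallyEq ?_).congr_deriv ?_
  · filter_upwards [hdiv.continuousAt.eventually hev] with x hx
    simp only [Lhat0, hx, Pi.add_apply, Pi.sub_apply, Pi.mul_apply, Function.comp_apply]
    rw [div_mul_cancel₀ _ hk.ne']
  · field_simp
    ring

lemma hasDerivAt_mul_Lhat0 {n k l : ℝ} {t : ℕ} (ht : 0 < t) (hn : 0 < n) (hk : 0 < k)
    (hρ : n / k < t) (hl : meanDefect t (n / k) l = 0) :
    HasDerivAt (fun k' => k' * Lhat0 n k' t) (log (partitionFn t l) - log k) k := by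
  have hd := (hasDerivAt_id k).mul (hasDerivAt_Lhat0_right ht hn hk hρ hl)
  refine hd.congr_deriv ?_
  simp only [Lhat0, Ltilde0_eq ht hl, id]
  rw [div_mul_cancel₀ _ hk.ne']
  field_simp
  ring

lemma dI_succ (m : ℕ) : dI (m + 1) = 2 ^ m * ((m : ℝ) + 1) * dI m := by
  simp only [dI, Nat.choose_succ_succ' m 1, Nat.choose_one_right, Nat.factorial_succ, pow_add]
  push_cast
  ring

lemma gibbsWeight_succ (l : ℝ) (m : ℕ) :
    gibbsWeight l (m + 1) * (2 ^ m * ((m : ℝ) + 1)) = exp l * gibbsWeight l m := by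
  have h := (dI_pos m).ne'
  rw [gibbsWeight, gibbsWeight, dI_succ]
  push_cast
  rw [mul_add, mul_one, exp_add]
  field_simp

lemma sum_fin_succ_eq_sum_range_sub (f : ℕ → ℝ) (t : ℕ) :
    ∑ i : Fin t, f (i.1 + 1) = ∑ j ∈ Finset.range t, f (t - j) := by
  rw [Fin.sum_univ_eq_sum_range (fun i => f (i + 1)) t, ← Finset.sum_range_reflect]
  refine Finset.sum_congr rfl fun j hj => ?_
  have := Finset.mem_range.1 hj
  congr 1
  omega

lemma meanDefect_eq_sum_range (t : ℕ) (ρ l : ℝ) :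
    meanDefect t ρ l = ∑ j ∈ Finset.range t, ((t : ℝ) - ρ - j) * gibbsWeight l (t - j) := by
  rw [meanDefect, sum_fin_succ_eq_sum_range_sub (fun m => ((m : ℝ) - ρ) * gibbsWeight l m)]
  refine Finset.sum_congr rfl fun j hj => ?_
  rw [Nat.cast_sub (Finset.mem_range.1 hj).le]
  ring

lemma gibbsWeight_sub_le {l y : ℝ} {t : ℕ} (hl : exp l * y = 2 ^ (t - 1) * t) (hy : 0 < y) :
    ∀ j ≤ t, gibbsWeight l (t - j) ≤ y ^ j * gibbsWeight l t := by
  intro j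
  induction j with
  | zero => simp
  | succ j ih =>
    intro hj
    obtain ⟨m, hm⟩ : ∃ m, t - j = m + 1 := ⟨t - j - 1, by omega⟩
    have hm' : t - (j + 1) = m := by omega
    have hstep : exp l * gibbsWeight l m ≤ exp l * (y * gibbsWeight l (m + 1)) := by
      rw [← gibbsWeight_succ, ← mul_assoc (exp l), hl, mul_comm]
      refine mul_le_mul_of_nonneg_right ?_ (gibbsWeight_pos _ _).le
      have h1 : (2 : ℝ) ^ m ≤ 2 ^ (t - 1) := pow_le_pow_right₀ one_le_two (by omega)
      have h2 : (m : ℝ) + 1 ≤ t := by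
        have : m + 1 ≤ t := by omega
        exact_mod_cast this
      exact mul_le_mul h1 h2 (by positivity) (by positivity)
    have h := le_of_mul_le_mul_left hstep (exp_pos l)
    have ih' := ih (by omega)
    rw [hm] at ih'
    rw [hm', pow_succ', mul_assoc]
    exact h.trans (mul_le_mul_of_nonneg_left ih' hy.le)

lemma sum_range_mul_pow_le {y : ℝ} (hy : 0 < y) (hy2 : y ≤ 1 / 2) (t : ℕ) :
    ∑ j ∈ Finset.range t, (j : ℝ) * y ^ j ≤ 4 * y := by
  have hs := hasSum_coe_mul_geometric_of_norm_lt_one (𝕜 := ℝ) (r := y)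
    (by rw [norm_eq_abs, abs_of_pos hy]; linarith)
  refine (sum_le_hasSum _ (fun _ _ => by positivity) hs).trans ?_
  rw [div_le_iff₀ (by nlinarith)]
  nlinarith [mul_nonneg hy.le (mul_nonneg (sub_nonneg.2 hy2) (by linarith : 0 ≤ 3 / 2 - y))]

lemma meanDefect_nonneg {ρ l y c : ℝ} {t : ℕ} (ht : 0 < t)
    (hl : exp l * y = 2 ^ (t - 1) * t) (hy : 0 < y) (hy2 : y ≤ 1 / 2) (hyc : 4 * y ≤ c)
    (hρ : c < t - ρ) : 0 ≤ meanDefect t ρ l := by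
  have hw := gibbsWeight_pos l t
  rw [meanDefect_eq_sum_range]
  have hterm : ∀ j ∈ Finset.range t,
      (if j = 0 then c * gibbsWeight l t else 0) - (j : ℝ) * y ^ j * gibbsWeight l t ≤
        ((t : ℝ) - ρ - j) * gibbsWeight l (t - j) := by
    intro j hj
    split_ifs with h
    · subst h
      simpa using mul_le_mul_of_nonneg_right hρ.le hw.le
    · have h1 := gibbsWeight_sub_le hl hy j (Finset.mem_range.1 hj).le
      have h2 := mul_le_mul_of_nonneg_left h1 (Nat.cast_nonneg (α := ℝ) j)
      have h3 := mul_nonneg (by linarith : 0 ≤ (t : ℝ) - ρ) (gibbsWeight_pos l (t - j)).le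
      nlinarith
  refine le_trans ?_ (Finset.sum_le_sum hterm)
  rw [Finset.sum_sub_distrib, Finset.sum_ite_eq' (Finset.range t) 0,
    if_pos (Finset.mem_range.2 ht), ← Finset.sum_mul, ← sub_mul]
  have := sum_range_mul_pow_le hy hy2 t
  exact mul_nonneg (by linarith) hw.le

lemma meanDefect_nonpos {ρ l C A : ℝ} {t J : ℕ} (hC : 0 < C) (hJ : C + 1 ≤ J)
    (hA : A = J * C + 1) (hl : exp l * (2 ^ (J + 1) * A) = 2 ^ (t - 1) * t) (hJt : 2 * J ≤ t)
    (hρ : t - ρ < C) : meanDefect t ρ l ≤ 0 := by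
  have hJ0 : 0 < J := by
    have : (0 : ℝ) < J := by linarith
    exact_mod_cast this
  have hA1 : 1 ≤ A := by
    rw [hA]
    nlinarith [(Nat.cast_nonneg J : (0 : ℝ) ≤ J)]
  have hstep : ∀ m : ℕ, m + 1 ≤ t → t ≤ m + J →
      A * gibbsWeight l (m + 1) ≤ gibbsWeight l m := by
    intro m hm1 hm2
    have hp : (0 : ℝ) < 2 ^ m * ((m : ℝ) + 1) := by positivity
    refine le_of_mul_le_mul_right ?_ hp
    rw [mul_assoc, gibbsWeight_succ, ← mul_assoc, mul_comm (gibbsWeight l m)]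
    refine mul_le_mul_of_nonneg_right ?_ (gibbsWeight_pos _ _).le
    refine le_of_mul_le_mul_left ?_ (by positivity : (0 : ℝ) < 2 ^ (J + 1))
    have h1 : (2 : ℝ) ^ (t - 1) ≤ 2 ^ (J + m) := pow_le_pow_right₀ one_le_two (by omega)
    have h2 : (t : ℝ) ≤ 2 * ((m : ℝ) + 1) := by
      have : t ≤ 2 * (m + 1) := by omega
      exact_mod_cast this
    calc (2 : ℝ) ^ (J + 1) * (A * exp l) = 2 ^ (t - 1) * t := by rw [← hl]; ring
      _ ≤ 2 ^ (J + m) * (2 * ((m : ℝ) + 1)) := mul_le_mul h1 h2 (by positivity) (by positivity)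
      _ = _ := by ring
  have hstep' : ∀ j d : ℕ, j + 1 + d ≤ J →
      A * gibbsWeight l (t - j) ≤ gibbsWeight l (t - (j + 1 + d)) := by
    intro j d
    induction d with
    | zero =>
      intro h
      have := hstep (t - (j + 1)) (by omega) (by omega)
      rwa [show t - (j + 1) + 1 = t - j by omega] at this
    | succ d ih =>
      intro h
      have := hstep (t - (j + 1 + (d + 1))) (by omega) (by omega)
      rw [show t - (j + 1 + (d + 1)) + 1 = t - (j + 1 + d) by omega] at this
      refine (ih (by omega)).trans (le_trans ?_ this)
      exact le_mul_of_one_le_left (gibbsWeight_pos _ _).le hA1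
  rw [meanDefect_eq_sum_range,
    ← Finset.sum_range_add_sum_Ico _ (by omega : J + 1 ≤ t), Finset.sum_range_succ]
  have hlow : ∑ j ∈ Finset.range J, ((t : ℝ) - ρ - j) * gibbsWeight l (t - j) ≤
      ∑ _j ∈ Finset.range J, C / A * gibbsWeight l (t - J) := by
    refine Finset.sum_le_sum fun j hj => ?_
    have hj' := Finset.mem_range.1 hj
    have h := hstep' j (J - (j + 1)) (by omega)
    rw [show j + 1 + (J - (j + 1)) = J by omega] at h
    have h1 : ((t : ℝ) - ρ - j) * gibbsWeight l (t - j) ≤ C * gibbsWeight l (t - j) := by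
      refine mul_le_mul_of_nonneg_right ?_ (gibbsWeight_pos _ _).le
      linarith [(Nat.cast_nonneg j : (0 : ℝ) ≤ j)]
    refine h1.trans ?_
    rw [div_mul_eq_mul_div, le_div_iff₀ (by linarith)]
    nlinarith
  have hhigh : ∑ j ∈ Finset.Ico (J + 1) t, ((t : ℝ) - ρ - j) * gibbsWeight l (t - j) ≤ 0 := by
    refine Finset.sum_nonpos fun j hj => ?_
    have h : ((J + 1 : ℕ) : ℝ) ≤ j := Nat.cast_le.2 (Finset.mem_Ico.1 hj).1
    push_cast at h
    exact mul_nonpos_of_nonpos_of_nonneg (by linarith) (gibbsWeight_pos _ _).le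
  have hmid : ((t : ℝ) - ρ - J) * gibbsWeight l (t - J) ≤ -1 * gibbsWeight l (t - J) :=
    mul_le_mul_of_nonneg_right (by linarith) (gibbsWeight_pos _ _).le
  rw [Finset.sum_const, Finset.card_range, nsmul_eq_mul] at hlow
  have hCA : (J : ℝ) * (C / A) ≤ 1 := by
    rw [← mul_div_assoc, div_le_one (by linarith)]
    linarith
  nlinarith [gibbsWeight_pos l (t - J)]

lemma exp_sub_log_mul {y : ℝ} {t : ℕ} (ht : 0 < t) (hy : 0 < y) :
    exp (((t : ℝ) - 1) * log 2 + log t - log y) * y = 2 ^ (t - 1) * t := by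
  have ht' : (0 : ℝ) < t := by exact_mod_cast ht
  rw [exp_sub, exp_add, exp_log hy, exp_log ht', div_mul_cancel₀ _ hy.ne',
    show (t : ℝ) - 1 = ((t - 1 : ℕ) : ℝ) by rw [Nat.cast_sub ht]; simp, exp_nat_mul,
    exp_log two_pos]

/-- If the mean is at bounded distance from `t`, the tilting parameter is
`(t - 1) log 2 + log t + O(1)`. -/
lemma exists_meanDefect_eq_zero_near {c C : ℝ} (hc : 0 < c) (hcC : c < C) :
    ∃ X : ℝ, 0 < X ∧ ∃ T : ℕ, ∀ t : ℕ, T ≤ t → ∀ ρ : ℝ, c < t - ρ → t - ρ < C →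
      ∃ l, |l - (((t : ℝ) - 1) * log 2 + log t)| ≤ X ∧ meanDefect t ρ l = 0 := by
  obtain ⟨J, hJ⟩ := exists_nat_ge (C + 1)
  set A : ℝ := J * C + 1 with hA
  set y₁ : ℝ := min (1 / 2) (c / 4) with hy₁
  set y₂ : ℝ := 2 ^ (J + 1) * A with hy₂
  have hC : 0 < C := hc.trans hcC
  have hA1 : 1 ≤ A := by
    rw [hA]
    nlinarith [(Nat.cast_nonneg J : (0 : ℝ) ≤ J)]
  have h1 : 0 < y₁ := lt_min (by norm_num) (by linarith)
  have h1' : y₁ ≤ 1 / 2 := min_le_left _ _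
  have h1'' : y₁ ≤ c / 4 := min_le_right _ _
  have h2 : 1 ≤ y₂ := one_le_mul_of_one_le_of_one_le (one_le_pow₀ one_le_two) hA1
  have hlog1 : log y₁ < 0 := log_neg h1 (by linarith)
  have hlog2 : 0 ≤ log y₂ := log_nonneg h2
  refine ⟨log y₂ - log y₁, by linarith, 2 * J + 1, fun t ht ρ hρ hρ' => ?_⟩
  obtain ⟨l, ⟨hl1, hl2⟩, hl⟩ := exists_meanDefect_eq_zero (ρ := ρ) (t := t)
    (a := ((t : ℝ) - 1) * log 2 + log t - log y₂)
    (b := ((t : ℝ) - 1) * log 2 + log t - log y₁) (by linarith)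
    (meanDefect_nonpos hC hJ hA (exp_sub_log_mul (by omega) (by linarith)) (by omega) hρ')
    (meanDefect_nonneg (by omega) (exp_sub_log_mul (by omega) h1) h1 h1' (by linarith) hρ)
  exact ⟨l, abs_le.2 ⟨by linarith, by linarith⟩, hl⟩

lemma log_dI (t : ℕ) : log (dI t) = (t : ℝ) * (t - 1) / 2 * log 2 + log t.factorial := by
  rw [dI, log_mul (by positivity) (by positivity), log_pow, Nat.cast_choose_two]

lemma log_factorial_le_mul_log (t : ℕ) : log t.factorial ≤ t * log t := by
  rw [← log_pow]
  exact log_le_log (by positivity) (by exact_mod_cast t.factorial_le_pow)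

lemma mul_log_sub_le_log_factorial (t : ℕ) : t * log t - t ≤ log t.factorial := by
  rcases Nat.eq_zero_or_pos t with rfl | ht
  · simp
  have h := pow_div_factorial_le_exp (t : ℝ) (Nat.cast_nonneg t) t
  have h2 := log_le_log (by positivity) h
  rw [log_exp, log_div (by positivity) (by positivity), log_pow] at h2
  linarith

lemma abs_log_partitionFn_sub_le {l X : ℝ} {t : ℕ} (ht : 0 < t)
    (hl : |l - (((t : ℝ) - 1) * log 2 + log t)| ≤ X) :
    |log (partitionFn t l) - (t : ℝ) ^ 2 * log 2 / 2| ≤ (2 * X + 3) * t := by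
  have ht' : (1 : ℝ) ≤ t := by exact_mod_cast ht
  have hX : 0 ≤ X := (abs_nonneg _).trans hl
  rw [abs_le] at hl
  set y := exp (((t : ℝ) - 1) * log 2 + log t - l) with hy
  have hly : exp l * y = 2 ^ (t - 1) * t := by
    have := exp_sub_log_mul (y := y) ht (exp_pos _)
    rwa [hy, log_exp, sub_sub_cancel] at this
  have hw := gibbsWeight_pos l t
  have hZ : partitionFn t l = ∑ j ∈ Finset.range t, gibbsWeight l (t - j) :=
    sum_fin_succ_eq_sum_range_sub (gibbsWeight l) t
  have hlow : gibbsWeight l t ≤ partitionFn t l := by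
    rw [hZ]
    exact Finset.single_le_sum (f := fun j => gibbsWeight l (t - j))
      (fun j _ => (gibbsWeight_pos _ _).le) (Finset.mem_range.2 ht)
  have hup : partitionFn t l ≤ t * (exp (t * X) * gibbsWeight l t) := by
    have : ∑ j ∈ Finset.range t, gibbsWeight l (t - j) ≤
        ∑ _j ∈ Finset.range t, exp (t * X) * gibbsWeight l t := by
      refine Finset.sum_le_sum fun j hj => ?_
      have hj' := (Finset.mem_range.1 hj).le
      refine (gibbsWeight_sub_le hly (exp_pos _) j hj').trans
        (mul_le_mul_of_nonneg_right ?_ hw.le)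
      have hj'' : (j : ℝ) ≤ t := by exact_mod_cast hj'
      rw [hy, ← exp_nat_mul, exp_le_exp]
      calc (j : ℝ) * (((t : ℝ) - 1) * log 2 + log t - l) ≤ j * X :=
            mul_le_mul_of_nonneg_left (by linarith) (Nat.cast_nonneg j)
        _ ≤ t * X := mul_le_mul_of_nonneg_right hj'' hX
    rw [hZ]
    simpa [Finset.sum_const, Finset.card_range, nsmul_eq_mul] using this
  have h1 := log_le_log hw hlow
  have h2 := log_le_log (partitionFn_pos ht l) hup
  rw [log_mul (by positivity) (by positivity), log_mul (by positivity) (by positivity),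
    log_exp] at h2
  have h3 : log (gibbsWeight l t) = l * t - log (dI t) := by
    rw [gibbsWeight, log_div (exp_pos _).ne' (dI_pos t).ne', log_exp]
  rw [h3, log_dI] at h1 h2
  have h4 := log_factorial_le_mul_log t
  have h5 := mul_log_sub_le_log_factorial t
  have h6 := log_le_sub_one_of_pos (by linarith : (0 : ℝ) < t)
  have h7 : log 2 < 1 := log_two_lt_d9.trans (by norm_num)
  have h8 : 0 < log 2 := log_pos one_lt_two
  have h9 := mul_le_mul_of_nonneg_right hl.1 (by linarith : (0 : ℝ) ≤ t)
  have h10 := mul_le_mul_of_nonneg_right hl.2 (by linarith : (0 : ℝ) ≤ t)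
  have h11 := mul_lt_mul_of_pos_left h7 (by linarith : (0 : ℝ) < t)
  have h12 := mul_pos (by linarith : (0 : ℝ) < t) h8
  have h13 := mul_nonneg (by linarith : (0 : ℝ) ≤ t) hX
  rw [abs_le]
  constructor <;> linarith

lemma alpha0_two_mul_log_two {n : ℝ} (hn : log n ≠ 0) :
    alpha0 2 n * log 2 = 2 * log n - 2 * log (log n) + (2 * log (log 2) + 2 - log 2) := by
  have h : log 2 ≠ 0 := (log_pos one_lt_two).ne'
  rw [alpha0, logb, logb, logb, log_div hn h, log_div (exp_pos 1).ne' two_ne_zero, log_exp]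
  field_simp
  ring

lemma log_log_isLittleO : (fun n : ℕ => log (log (n : ℝ))) =o[atTop] fun n : ℕ => log (n : ℝ) :=
  isLittleO_log_id_atTop.comp_tendsto (tendsto_log_atTop.comp tendsto_natCast_atTop_atTop)

lemma tilt_estimates {T x X L s : ℝ} {t : ℕ} (hL : 0 < L) (hs : s = log L) (hs2 : 2 ≤ s)
    (hXs : X ≤ s) (hsL : 10 * s ≤ L) (hT : T = t * log 2)
    (hT1 : 2 * L - 3 * s ≤ T) (hT2 : T ≤ 2 * L - s)
    (hx : |x - (((t : ℝ) - 1) * log 2 + log t)| ≤ X) :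
    L ≤ t ∧ (t : ℝ) ≤ 4 * L ∧ L / 2 ≤ x - L ∧ x - L ≤ 2 * L := by
  have h1 : log 2 < 1 := log_two_lt_d9.trans (by norm_num)
  have h2 : 1 / 2 < log 2 := lt_trans (by norm_num) log_two_gt_d9
  have ht0 : (0 : ℝ) ≤ t := Nat.cast_nonneg t
  have ht1 : L ≤ t := by nlinarith
  have ht2 : (t : ℝ) ≤ 4 * L := by nlinarith
  have h3 : s ≤ log t := hs ▸ log_le_log hL ht1
  have h4 : log t ≤ 2 + s := by
    have h := log_le_log (by linarith) ht2
    rw [log_mul (by norm_num) hL.ne', ← hs, show (4 : ℝ) = 2 ^ 2 by norm_num, log_pow] at h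
    push_cast at h
    linarith
  rw [abs_le] at hx
  refine ⟨ht1, ht2, ?_, ?_⟩ <;> linarith

lemma abs_sub_le_of_log_partitionFn {P T k n ρ M L s : ℝ} {t : ℕ} (hL : L = log n)
    (hs : s = log L) (hs2 : 2 ≤ s) (hL0 : 0 < L) (hsL : 10 * s ≤ L) (hT : T = t * log 2)
    (hT1 : 2 * L - 3 * s ≤ T) (hT2 : T ≤ 2 * L - s) (ht : (t : ℝ) ≤ 4 * L) (hM : 0 ≤ M)
    (hP : |P - (t : ℝ) ^ 2 * log 2 / 2| ≤ M * t) (hn : 0 < n) (hk : 0 < k) (hρ : ρ = n / k)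
    (hρ1 : 1 ≤ ρ) (hρ2 : ρ ≤ 4 * L) :
    |P - log k - 2 / log 2 * L ^ 2| ≤ (13 + 4 * M) * L * s := by
  have h2 : 1 / 2 < log 2 := lt_trans (by norm_num) log_two_gt_d9
  have hlogρ : log ρ = L - log k := by rw [hρ, log_div hn.ne' hk.ne', hL]
  have h3 : 0 ≤ log ρ := log_nonneg hρ1
  have h4 : log ρ ≤ 2 + s := by
    have h := log_le_log (by linarith) hρ2
    have h1 : log 2 < 1 := log_two_lt_d9.trans (by norm_num)
    rw [log_mul (by norm_num) hL0.ne', ← hs, show (4 : ℝ) = 2 ^ 2 by norm_num, log_pow] at h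
    push_cast at h
    linarith
  have hLs : L ≤ L * s := le_mul_of_one_le_right hL0.le (by linarith)
  have hMt : M * t ≤ 4 * M * L * s := by nlinarith
  have hsq : |(t : ℝ) ^ 2 * log 2 / 2 - 2 / log 2 * L ^ 2| ≤ 12 * L * s := by
    have : (t : ℝ) ^ 2 * log 2 / 2 - 2 / log 2 * L ^ 2 = (T ^ 2 - 4 * L ^ 2) / (2 * log 2) := by
      rw [hT]
      field_simp
      ring
    rw [this, abs_div, abs_of_pos (by linarith : 0 < 2 * log 2), div_le_iff₀ (by linarith)]
    have hT4 : |T ^ 2 - 4 * L ^ 2| ≤ 12 * L * s := by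
      rw [show T ^ 2 - 4 * L ^ 2 = (T - 2 * L) * (T + 2 * L) by ring, abs_mul]
      have ha : |T - 2 * L| ≤ 3 * s := abs_le.2 ⟨by linarith, by linarith⟩
      have hb : |T + 2 * L| ≤ 4 * L := abs_le.2 ⟨by linarith, by linarith⟩
      calc |T - 2 * L| * |T + 2 * L| ≤ 3 * s * (4 * L) :=
            mul_le_mul ha hb (abs_nonneg _) (by linarith)
        _ = _ := by ring
    refine hT4.trans (le_mul_of_one_le_right (by nlinarith) (by linarith))
  rw [abs_le] at hP hsq ⊢
  constructor <;> linarith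

/-- Take `p = 1/2` and suppose `t(n)` is a positive integer with
`t(n) = α₀(n) + O(1)`.  Uniformly over `k ≤ n/2` with `n/k = t(n) − Θ(1)`:
`∂L̂₀/∂k = Θ(log³ n / n)`, `∂L̂₀/∂n = −Θ(log² n / n)`, and
`∂(k L̂₀)/∂k = (2/log 2) log² n + O(log n log log n)`. -/
theorem Lhat0_deriv_bounds (t : ℕ → ℕ) (ht0 : ∀ n, 0 < t n)
    (htO : ∃ C₀ : ℝ, ∀ᶠ n : ℕ in atTop, |(t n : ℝ) - alpha0 2 n| ≤ C₀) :
    ∀ C c : ℝ, 0 < c → c < C →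
    ∃ c' C' : ℝ, 0 < c' ∧ 0 < C' ∧ ∃ n₀ : ℕ, ∀ n : ℕ, n₀ ≤ n → ∀ k : ℝ, 0 < k →
      k ≤ (n : ℝ) / 2 →
      c < (t n : ℝ) - (n : ℝ) / k → (t n : ℝ) - (n : ℝ) / k < C →
      (∃ d : ℝ, HasDerivAt (fun k' => Lhat0 (n : ℝ) k' (t n)) d k ∧
        c' * Real.log n ^ 3 / n ≤ d ∧ d ≤ C' * Real.log n ^ 3 / n) ∧
      (∃ d : ℝ, HasDerivAt (fun x => Lhat0 x k (t n)) d (n : ℝ) ∧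
        -(C' * Real.log n ^ 2 / n) ≤ d ∧ d ≤ -(c' * Real.log n ^ 2 / n)) ∧
      (∃ d : ℝ, HasDerivAt (fun k' => k' * Lhat0 (n : ℝ) k' (t n)) d k ∧
        |d - 2 / Real.log 2 * Real.log n ^ 2| ≤ C' * Real.log n * Real.log (Real.log n)) := by
  intro C c hc hcC
  obtain ⟨C₀, hC₀⟩ := htO
  obtain ⟨X, hX, T₀, hroot⟩ := exists_meanDefect_eq_zero_near hc hcC
  set g : ℝ := 2 * log (log 2) + 2 - log 2 with hg
  set M : ℝ := 2 * X + 3 with hM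
  have hlog : Tendsto (fun n : ℕ => log (n : ℝ)) atTop atTop :=
    tendsto_log_atTop.comp tendsto_natCast_atTop_atTop
  have hev := ((hC₀.and (hlog.eventually_ge_atTop T₀)).and
    (((tendsto_log_atTop.comp hlog).eventually_ge_atTop (|C₀| + |g| + X + C + 2)).and
      (log_log_isLittleO.bound (by norm_num : (0 : ℝ) < 1 / 10)))).and
        (hlog.eventually_gt_atTop 0)
  obtain ⟨n₀, hn₀⟩ := eventually_atTop.1 hev
  refine ⟨1 / 8, 48 + 4 * M, by norm_num, by positivity, n₀, ?_⟩
  intro n hn k hk _ hck hCk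
  obtain ⟨⟨⟨hα, hLT⟩, hs, hsL⟩, hL0⟩ := hn₀ n hn
  simp only [Function.comp_apply] at hs
  set L := log (n : ℝ) with hL
  set s := log L with hsdef
  set ρ := (n : ℝ) / k with hρ
  have hn0 : (0 : ℝ) < n := by
    rcases (Nat.cast_nonneg n : (0 : ℝ) ≤ n).eq_or_lt with h | h
    · rw [hL, ← h, log_zero] at hL0
      exact absurd hL0 (lt_irrefl 0)
    · exact h
  have hC₀' := abs_nonneg C₀
  have hg' := abs_nonneg g
  have hs2 : 2 ≤ s := by linarith
  have hsL' : 10 * s ≤ L := by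
    rw [norm_eq_abs, norm_eq_abs, abs_of_pos hL0, abs_of_pos (by linarith)] at hsL
    linarith
  have hT : |(t n : ℝ) * log 2 - (2 * L - 2 * s)| ≤ s := by
    have h2 : 0 < log 2 := log_pos one_lt_two
    have h1 : log 2 < 1 := log_two_lt_d9.trans (by norm_num)
    have h3 := alpha0_two_mul_log_two hL0.ne'
    rw [← hg, ← hL, ← hsdef] at h3
    have h4 : (t n : ℝ) * log 2 - (2 * L - 2 * s) = ((t n : ℝ) - alpha0 2 n) * log 2 + g := by
      rw [sub_mul, h3]
      ring
    have h5 : |(t n : ℝ) - alpha0 2 n| * log 2 ≤ |C₀| :=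
      (mul_le_of_le_one_right (abs_nonneg _) h1.le).trans (hα.trans (le_abs_self _))
    rw [h4]
    refine (abs_add_le _ _).trans ?_
    rw [abs_mul, abs_of_pos h2]
    linarith
  rw [abs_le] at hT
  have hT1 : 2 * L - 3 * s ≤ t n * log 2 := by linarith
  have hT2 : t n * log 2 ≤ 2 * L - s := by linarith
  have htT : T₀ ≤ t n := by
    have h1 : log 2 < 1 := log_two_lt_d9.trans (by norm_num)
    have h : (T₀ : ℝ) ≤ t n := by nlinarith [(Nat.cast_nonneg (t n) : (0 : ℝ) ≤ t n)]
    exact_mod_cast h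
  obtain ⟨x, hx, hx0⟩ := hroot (t n) htT ρ hck hCk
  obtain ⟨ht1, ht2, hx1, hx2⟩ :=
    tilt_estimates hL0 hsdef hs2 (by linarith) hsL' rfl hT1 hT2 hx
  have hρt : ρ < t n := by linarith
  have hρ1 : L / 2 ≤ ρ := by linarith
  have hρ2 : ρ ≤ 4 * L := by linarith
  have hL20 : 20 ≤ L := by linarith
  have ht0' := ht0 n
  refine ⟨⟨_, hasDerivAt_Lhat0_right ht0' hn0 hk hρt hx0, ?_, ?_⟩,
    ⟨_, hasDerivAt_Lhat0_left ht0' hn0 hk hρt hx0, ?_, ?_⟩,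
    ⟨_, hasDerivAt_mul_Lhat0 ht0' hn0 hk hρt hx0, ?_⟩⟩
  · rw [← hρ, ← hL, div_mul_eq_mul_div ρ]
    refine div_le_div_of_nonneg_right ?_ hn0.le
    have h1 : L / 2 * (L / 2) ≤ ρ * (x + 1 - L) - 1 := by nlinarith
    calc 1 / 8 * L ^ 3 = L / 2 * (L / 2 * (L / 2)) := by ring
      _ ≤ _ := mul_le_mul hρ1 h1 (by positivity) (by linarith)
  · rw [← hρ, ← hL, div_mul_eq_mul_div ρ]
    refine div_le_div_of_nonneg_right ?_ hn0.le
    have h1 : ρ * (x + 1 - L) - 1 ≤ 4 * L * (3 * L) :=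
      (sub_le_self _ zero_le_one).trans
        (mul_le_mul hρ2 (by linarith) (by linarith) (by linarith))
    have h2 : ρ * (ρ * (x + 1 - L) - 1) ≤ 4 * L * (4 * L * (3 * L)) :=
      mul_le_mul hρ2 h1 (by nlinarith) (by linarith)
    have h3 : 0 ≤ 4 * M * L ^ 3 := by positivity
    linarith
  · rw [← hρ, ← hL, div_mul_eq_mul_div ρ, ← neg_div]
    refine div_le_div_of_nonneg_right ?_ hn0.le
    have h1 : ρ * (x - L) ≤ 4 * L * (2 * L) :=
      mul_le_mul hρ2 hx2 (by linarith) (by linarith)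
    have h3 : 0 ≤ (40 + 4 * M) * L ^ 2 := by positivity
    linarith
  · rw [← hρ, ← hL, div_mul_eq_mul_div ρ, ← neg_div]
    refine div_le_div_of_nonneg_right ?_ hn0.le
    have h1 : L / 2 * (L / 2) ≤ ρ * (x - L) :=
      mul_le_mul hρ1 hx1 (by linarith) (by linarith)
    nlinarith
  · refine (abs_sub_le_of_log_partitionFn hL hsdef hs2 hL0 hsL' rfl hT1 hT2 ht2
      (by linarith) (abs_log_partitionFn_sub_le ht0' hx) hn0 hk hρ (by linarith) hρ2).trans ?_
    have h : 0 ≤ L * s := mul_nonneg hL0.le (by linarith)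
    linarith
end
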